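/- Assume λ = sup_k m_k < ∞. There exists a constant c, depending only on λ, such that for all N ∈ ℕ_+, all i, j with 0 ≤ i < j ≤ N, all x ∈ I_N^{i,j}, and all n ∈ ℕ_+ with n ≥ M_N, one has ∫_{I_N} |K_n(x − t)| dμ(t) ≤ c · M_i M_j / M_N². -/

import Mathlib

open MeasureTheory Finset

noncomputable section

namespace Vilenkin

instance (n : ℕ) : MeasurableSpace (ZMod n) := ⊤

abbrev G (m : ℕ → ℕ) : Type := ∀ k, ZMod (m k)

def M (m : ℕ → ℕ) : ℕ → ℕ
  | 0 => 1
  | k + 1 => m k * M m k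

def digit (m : ℕ → ℕ) (n k : ℕ) : ℕ := (n / M m k) % m k

def rad (m : ℕ → ℕ) (k : ℕ) (x : G m) : ℂ :=
  Complex.exp (2 * (Real.pi : ℂ) * Complex.I * ((x k).val : ℂ) / (m k : ℂ))

def psi (m : ℕ → ℕ) (n : ℕ) (x : G m) : ℂ :=
  ∏ k ∈ Finset.range (n + 1), rad m k x ^ digit m n k

def D (m : ℕ → ℕ) (n : ℕ) (x : G m) : ℂ := ∑ k ∈ Finset.range n, psi m k x

def K (m : ℕ → ℕ) (n : ℕ) (x : G m) : ℂ := (n : ℂ)⁻¹ * ∑ k ∈ Finset.range n, D m k x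

def cyl (m : ℕ → ℕ) (n : ℕ) (x : G m) : Set (G m) := {y | ∀ j < n, y j = x j}

def e (m : ℕ → ℕ) (k : ℕ) : G m := fun j => if j = k then 1 else 0

def lo (m : ℕ → ℕ) (n : ℕ) : ℕ := sInf {j | digit m n j ≠ 0}

def hi (m : ℕ → ℕ) (n : ℕ) : ℕ := sSup {j | digit m n j ≠ 0}

def Iij (m : ℕ → ℕ) (N i j : ℕ) : Set (G m) :=
  if j = N then {x | x i ≠ 0 ∧ ∀ t < N, t ≠ i → x t = 0}
  else {x | (∀ t < i, x t = 0) ∧ x i ≠ 0 ∧ (∀ t, i < t → t < j → x t = 0) ∧ x j ≠ 0}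

def IsVilenkinMeasure (m : ℕ → ℕ) (μ : Measure (G m)) : Prop :=
  IsProbabilityMeasure μ ∧ ∀ (n : ℕ) (x : G m), μ (cyl m n x) = (M m n : ENNReal)⁻¹

def fhat (m : ℕ → ℕ) (μ : Measure (G m)) (f : G m → ℂ) (k : ℕ) : ℂ :=
  ∫ x, f x * (starRingEnd ℂ) (psi m k x) ∂μ

def S (m : ℕ → ℕ) (μ : Measure (G m)) (f : G m → ℂ) (n : ℕ) (x : G m) : ℂ :=
  ∑ k ∈ Finset.range n, fhat m μ f k * psi m k x

def sigma (m : ℕ → ℕ) (μ : Measure (G m)) (f : G m → ℂ) (n : ℕ) (x : G m) : ℂ :=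
  (n : ℂ)⁻¹ * ∑ k ∈ Finset.range n, S m μ f k x

end Vilenkin

open Vilenkin

namespace Vilenkin

variable {m : ℕ → ℕ}

lemma M_pos (hm : ∀ k, 2 ≤ m k) (k : ℕ) : 0 < M m k := by
  induction k with
  | zero => simp [M]
  | succ k ih => exact Nat.mul_pos (by linarith [hm k]) ih

lemma two_pow_mul_M_le (hm : ∀ k, 2 ≤ m k) (N k : ℕ) : 2 ^ k * M m N ≤ M m (N + k) := by
  induction k with
  | zero => simp
  | succ k ih =>
    calc 2 ^ (k + 1) * M m N = 2 * (2 ^ k * M m N) := by ring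
      _ ≤ m (N + k) * M m (N + k) := Nat.mul_le_mul (hm _) ih

lemma M_mono (hm : ∀ k, 2 ≤ m k) : Monotone (M m) := by
  refine monotone_nat_of_le_succ fun k => ?_
  exact Nat.le_mul_of_pos_left _ (by linarith [hm k])

lemma lt_M_self (hm : ∀ k, 2 ≤ m k) (n : ℕ) : n < M m n := by
  have h := two_pow_mul_M_le hm 0 n
  simp only [M, mul_one, zero_add] at h
  exact n.lt_two_pow_self.trans_le h

lemma sum_M_le (hm : ∀ k, 2 ≤ m k) (k : ℕ) : ∑ l ∈ range k, M m l ≤ M m k := by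
  induction k with
  | zero => simp
  | succ k ih =>
    rw [sum_range_succ]
    calc _ ≤ 2 * M m k := by linarith
      _ ≤ m k * M m k := Nat.mul_le_mul_right _ (hm k)

lemma M_dvd_of_le {s t : ℕ} (h : s ≤ t) : M m s ∣ M m t := by
  induction t, h using Nat.le_induction with
  | base => exact dvd_rfl
  | succ t _ ih => exact ih.mul_left _

lemma digit_eq_zero_of_lt (hm : ∀ k, 2 ≤ m k) {n s k : ℕ} (hn : n < M m s) (hk : s ≤ k) :
    digit m n k = 0 := by
  rw [digit, Nat.div_eq_of_lt (hn.trans_le (M_mono hm hk)), Nat.zero_mod]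

lemma digit_mul_add_of_lt (hm : ∀ k, 2 ≤ m k) {a k s t : ℕ} (ht : t < s) :
    digit m (a * M m s + k) t = digit m k t := by
  obtain ⟨q, hq⟩ := M_dvd_of_le (m := m) (show t + 1 ≤ s from ht)
  have h : a * M m s + k = k + M m t * (m t * (a * q)) := by
    rw [hq, M]
    ring
  rw [digit, digit, h, Nat.add_mul_div_left _ _ (M_pos hm t), Nat.add_mul_mod_self_left]

lemma digit_mul_add_self {a k s : ℕ} (hk : k < M m s) (ha : a < m s) :
    digit m (a * M m s + k) s = a := by
  rw [digit, Nat.add_comm, Nat.add_mul_div_right _ _ (by omega), Nat.div_eq_of_lt hk, zero_add,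
    Nat.mod_eq_of_lt ha]

lemma psi_eq_prod (hm : ∀ k, 2 ≤ m k) {n s : ℕ} (hn : n < M m s) (x : G m) :
    psi m n x = ∏ k ∈ range s, rad m k x ^ digit m n k := by
  have hn' : n < M m (n + 1) := (lt_M_self hm n).trans_le (M_mono hm n.le_succ)
  rw [psi]
  rcases le_total s (n + 1) with h | h
  · refine (prod_subset (range_subset_range.2 h) fun k _ hk => ?_).symm
    rw [digit_eq_zero_of_lt hm hn (by simpa using hk), pow_zero]
  · refine prod_subset (range_subset_range.2 h) fun k _ hk => ?_
    rw [digit_eq_zero_of_lt hm hn' (by simpa using hk), pow_zero]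

lemma psi_mul_add (hm : ∀ k, 2 ≤ m k) {a k s : ℕ} (hk : k < M m s) (ha : a < m s) (x : G m) :
    psi m (a * M m s + k) x = rad m s x ^ a * psi m k x := by
  have h : a * M m s + k < M m (s + 1) :=
    calc a * M m s + k < (a + 1) * M m s := by linarith
      _ ≤ m s * M m s := Nat.mul_le_mul_right _ ha
  rw [psi_eq_prod hm h, psi_eq_prod hm hk, prod_range_succ, digit_mul_add_self hk ha, mul_comm]
  congr 1
  exact prod_congr rfl fun t ht => by rw [digit_mul_add_of_lt hm (mem_range.1 ht)]

lemma rad_eq_pow (k : ℕ) (x : G m) :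
    rad m k x = Complex.exp (2 * Real.pi * Complex.I / m k) ^ (x k).val := by
  rw [rad, ← Complex.exp_nat_mul]
  ring_nf

lemma norm_rad (k : ℕ) (x : G m) : ‖rad m k x‖ = 1 := by
  have h : 2 * (Real.pi : ℂ) * Complex.I * ((x k).val : ℂ) / (m k : ℂ) =
      ((2 * Real.pi * (x k).val / m k : ℝ) : ℂ) * Complex.I := by
    push_cast
    ring
  rw [rad, h, Complex.norm_exp_ofReal_mul_I]

lemma norm_psi (n : ℕ) (x : G m) : ‖psi m n x‖ = 1 := by
  simp [psi, norm_rad]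

lemma sum_rad_pow_eq_zero (hm : ∀ k, 2 ≤ m k) {k : ℕ} {x : G m} (hx : x k ≠ 0) :
    ∑ b ∈ range (m k), rad m k x ^ b = 0 := by
  have h0 : m k ≠ 0 := by linarith [hm k]
  have : NeZero (m k) := ⟨h0⟩
  have hζ := Complex.isPrimitiveRoot_exp (m k) h0
  have h1 : rad m k x ≠ 1 := by
    rw [rad_eq_pow]
    intro h
    have hd := (hζ.pow_eq_one_iff_dvd _).1 h
    exact hx ((ZMod.val_eq_zero _).1 (Nat.eq_zero_of_dvd_of_lt hd (ZMod.val_lt _)))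
  have h2 : rad m k x ^ m k = 1 := by
    rw [rad_eq_pow, pow_right_comm, hζ.pow_eq_one, one_pow]
  rw [geom_sum_eq h1, h2, sub_self, zero_div]

lemma norm_sum_rad_pow_le (k a : ℕ) (x : G m) : ‖∑ b ∈ range a, rad m k x ^ b‖ ≤ a := by
  refine (norm_sum_le _ _).trans ?_
  simp [norm_rad]

lemma norm_sum_sum_rad_pow_le (k a : ℕ) (x : G m) :
    ‖∑ b ∈ range a, ∑ d ∈ range b, rad m k x ^ d‖ ≤ (a : ℝ) ^ 2 := by
  calc _ ≤ ∑ b ∈ range a, (a : ℝ) := by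
        refine norm_sum_le_of_le _ fun b hb => (norm_sum_rad_pow_le k b x).trans ?_
        exact_mod_cast (mem_range.1 hb).le
    _ = (a : ℝ) ^ 2 := by simp [sq]

lemma norm_D_le (n : ℕ) (x : G m) : ‖D m n x‖ ≤ n := by
  refine (norm_sum_le _ _).trans ?_
  simp [norm_psi]

lemma D_mul_add (hm : ∀ k, 2 ≤ m k) {a r s : ℕ} (hr : r ≤ M m s) (ha : a < m s) (x : G m) :
    D m (a * M m s + r) x = D m (a * M m s) x + rad m s x ^ a * D m r x := by
  rw [D, sum_range_add, ← D, D, D, mul_sum]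
  congr 1
  exact sum_congr rfl fun k hk => psi_mul_add hm ((mem_range.1 hk).trans_le hr) ha x

lemma D_mul (hm : ∀ k, 2 ≤ m k) {a s : ℕ} (ha : a ≤ m s) (x : G m) :
    D m (a * M m s) x = (∑ b ∈ range a, rad m s x ^ b) * D m (M m s) x := by
  induction a with
  | zero => simp [D]
  | succ a ih =>
    rw [Nat.succ_mul, D_mul_add hm le_rfl ha, ih (by omega), sum_range_succ, add_mul]

lemma D_M_eq_zero (hm : ∀ k, 2 ≤ m k) {s t : ℕ} (hts : t < s) {x : G m} (hx : x t ≠ 0) :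
    D m (M m s) x = 0 := by
  induction s, hts using Nat.le_induction with
  | base => rw [M, D_mul hm le_rfl, sum_rad_pow_eq_zero hm hx, zero_mul]
  | succ s _ ih => rw [M, D_mul hm le_rfl, ih, mul_zero]

/-- The unnormalized Fejér kernel `n * K n`. -/
def fejerSum (m : ℕ → ℕ) (n : ℕ) (x : G m) : ℂ := ∑ k ∈ range n, D m k x

lemma norm_fejerSum_le (n : ℕ) (x : G m) : ‖fejerSum m n x‖ ≤ (n : ℝ) ^ 2 := by
  calc _ ≤ ∑ k ∈ range n, (n : ℝ) := by
        refine norm_sum_le_of_le _ fun k hk => (norm_D_le k x).trans ?_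
        exact_mod_cast (mem_range.1 hk).le
    _ = (n : ℝ) ^ 2 := by simp [sq]

lemma fejerSum_mul_add (hm : ∀ k, 2 ≤ m k) {a r s : ℕ} (hr : r ≤ M m s) (ha : a < m s)
    (x : G m) :
    fejerSum m (a * M m s + r) x =
      fejerSum m (a * M m s) x + r * D m (a * M m s) x + rad m s x ^ a * fejerSum m r x := by
  have h : ∀ k ∈ range r, D m (a * M m s + k) x = D m (a * M m s) x + rad m s x ^ a * D m k x :=
    fun k hk => D_mul_add hm ((mem_range.1 hk).le.trans hr) ha x
  rw [fejerSum, sum_range_add, sum_congr rfl h, sum_add_distrib, ← mul_sum, fejerSum, fejerSum]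
  simp [add_assoc]

lemma fejerSum_mul (hm : ∀ k, 2 ≤ m k) {a s : ℕ} (ha : a ≤ m s) (x : G m) :
    fejerSum m (a * M m s) x =
      (∑ b ∈ range a, rad m s x ^ b) * fejerSum m (M m s) x +
        M m s * (∑ b ∈ range a, ∑ d ∈ range b, rad m s x ^ d) * D m (M m s) x := by
  induction a with
  | zero => simp [fejerSum]
  | succ a ih =>
    rw [Nat.succ_mul, fejerSum_mul_add hm le_rfl ha, ih (by omega), D_mul hm (by omega),
      sum_range_succ _ a, sum_range_succ _ a]
    ring

lemma norm_fejerSum_le_sum {lam : ℕ} (hm : ∀ k, 2 ≤ m k) (hlam : ∀ k, m k ≤ lam) (x : G m)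
    {n s : ℕ} (hn : n < M m s) :
    ‖fejerSum m n x‖ ≤ ∑ l ∈ range s, ((lam : ℝ) * ‖fejerSum m (M m l) x‖ +
      2 * (lam : ℝ) ^ 2 * (M m l * ‖D m (M m l) x‖)) := by
  induction s generalizing n with
  | zero =>
    obtain rfl : n = 0 := by simpa [M] using hn
    simp [fejerSum]
  | succ s ih =>
    have hr : n % M m s < M m s := Nat.mod_lt _ (M_pos hm s)
    have ha : n / M m s < m s := Nat.div_lt_of_lt_mul (by rwa [mul_comm])
    rw [← Nat.div_add_mod' n (M m s)]
    set a := n / M m s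
    set r := n % M m s
    have hal : (a : ℝ) ≤ lam := by exact_mod_cast ha.le.trans (hlam s)
    have hlam1 : (1 : ℝ) ≤ lam := by exact_mod_cast one_le_two.trans ((hm 0).trans (hlam 0))
    have hrM : (r : ℝ) ≤ M m s := by exact_mod_cast hr.le
    have hs1 := (norm_sum_rad_pow_le s a x).trans hal
    have hs2 := (norm_sum_sum_rad_pow_le s a x).trans
      (pow_le_pow_left₀ (Nat.cast_nonneg a) hal 2)
    have h1 : ‖fejerSum m (a * M m s) x‖ ≤
        lam * ‖fejerSum m (M m s) x‖ + lam ^ 2 * (M m s * ‖D m (M m s) x‖) := by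
      rw [fejerSum_mul hm ha.le]
      refine (norm_add_le _ _).trans ?_
      rw [norm_mul, norm_mul, norm_mul, Complex.norm_natCast, mul_assoc, mul_left_comm]
      gcongr
    have h2 : ‖(r : ℂ) * D m (a * M m s) x‖ ≤ lam ^ 2 * (M m s * ‖D m (M m s) x‖) := by
      rw [D_mul hm ha.le, norm_mul, norm_mul, Complex.norm_natCast, mul_left_comm]
      gcongr
      exact hs1.trans (le_self_pow₀ hlam1 two_ne_zero)
    have h3 : ‖rad m s x ^ a * fejerSum m r x‖ = ‖fejerSum m r x‖ := by
      rw [norm_mul, norm_pow, norm_rad, one_pow, one_mul]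
    rw [fejerSum_mul_add hm hr.le ha, sum_range_succ]
    refine (norm_add₃_le).trans ?_
    linarith [ih hr]

section FirstNonzero

variable {lam i : ℕ} {y : G m}

lemma norm_D_M_le (hm : ∀ k, 2 ≤ m k) (hi : y i ≠ 0) (l : ℕ) :
    ‖D m (M m l) y‖ ≤ M m i := by
  rcases le_or_gt l i with h | h
  · exact (norm_D_le _ _).trans (by exact_mod_cast M_mono hm h)
  · simp [D_M_eq_zero hm h hi]

lemma norm_fejerSum_M_le (hm : ∀ k, 2 ≤ m k) (hlam : ∀ k, m k ≤ lam) (hi : y i ≠ 0) (l : ℕ) :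
    ‖fejerSum m (M m l) y‖ ≤ (lam : ℝ) ^ 2 * (M m i * M m l) := by
  have hlam1 : (1 : ℝ) ≤ lam := by exact_mod_cast one_le_two.trans ((hm 0).trans (hlam 0))
  have small : ∀ l ≤ i, ‖fejerSum m (M m l) y‖ ≤ (lam : ℝ) ^ 2 * (M m i * M m l) := by
    intro l hl
    have hMl : (M m l : ℝ) ≤ M m i := by exact_mod_cast M_mono hm hl
    calc _ ≤ (M m l : ℝ) ^ 2 := norm_fejerSum_le _ _
      _ = 1 * (M m l * M m l) := by ring
      _ ≤ _ := by
        gcongr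
        exact one_le_pow₀ hlam1
  induction l with
  | zero => exact small 0 (Nat.zero_le _)
  | succ s ih =>
    rcases lt_trichotomy s i with h | rfl | h
    · exact small _ h
    · have hMl : (M m s : ℝ) ≤ M m (s + 1) := by exact_mod_cast M_mono hm s.le_succ
      have hms : (m s : ℝ) ≤ lam := by exact_mod_cast hlam s
      have h2 := (norm_sum_sum_rad_pow_le s (m s) y).trans
        (pow_le_pow_left₀ (Nat.cast_nonneg _) hms 2)
      calc ‖fejerSum m (M m (s + 1)) y‖
          = ‖∑ b ∈ range (m s), ∑ d ∈ range b, rad m s y ^ d‖ *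
              (M m s * ‖D m (M m s) y‖) := by
            rw [M, fejerSum_mul hm le_rfl, sum_rad_pow_eq_zero hm hi, zero_mul, zero_add,
              norm_mul, norm_mul, Complex.norm_natCast]
            ring
        _ ≤ (lam : ℝ) ^ 2 * (M m s * M m (s + 1)) := by
            gcongr
            exact (norm_D_le _ _).trans hMl
    · calc ‖fejerSum m (M m (s + 1)) y‖
          = ‖∑ b ∈ range (m s), rad m s y ^ b‖ * ‖fejerSum m (M m s) y‖ := by
            rw [M, fejerSum_mul hm le_rfl, D_M_eq_zero hm h hi, mul_zero, add_zero, norm_mul]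
        _ ≤ m s * ((lam : ℝ) ^ 2 * (M m i * M m s)) := by
            gcongr
            exact norm_sum_rad_pow_le _ _ _
        _ = (lam : ℝ) ^ 2 * (M m i * M m (s + 1)) := by
            rw [M]
            push_cast
            ring

lemma fejerSum_M_eq_zero (hm : ∀ k, 2 ≤ m k) (hi : y i ≠ 0) {t l : ℕ} (hit : i < t)
    (htl : t < l) (ht : y t ≠ 0) : fejerSum m (M m l) y = 0 := by
  induction l, htl using Nat.le_induction with
  | base =>
    rw [M, fejerSum_mul hm le_rfl, D_M_eq_zero hm hit hi, sum_rad_pow_eq_zero hm ht]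
    simp
  | succ s hs ih =>
    rw [M, fejerSum_mul hm le_rfl, D_M_eq_zero hm (by omega) hi, ih]
    simp

/-- The points all of whose coordinates strictly between `i` and `l` vanish. -/
def zeroBetween (m : ℕ → ℕ) (i l : ℕ) : Set (G m) := {y | ∀ t, i < t → t < l → y t = 0}

lemma norm_fejerSum_le_sum_indicator (hm : ∀ k, 2 ≤ m k) (hlam : ∀ k, m k ≤ lam)
    (hi : y i ≠ 0) {n s : ℕ} (hn : n < M m s) :
    ‖fejerSum m n y‖ ≤ ((lam : ℝ) ^ 3 + 2 * (lam : ℝ) ^ 2) * M m i *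
      ∑ l ∈ range s, (M m l : ℝ) * (zeroBetween m i l).indicator 1 y := by
  refine (norm_fejerSum_le_sum hm hlam y hn).trans ?_
  rw [mul_sum]
  refine sum_le_sum fun l _ => ?_
  by_cases h : y ∈ zeroBetween m i l
  · rw [Set.indicator_of_mem h]
    have h1 := norm_fejerSum_M_le hm hlam hi l
    have h2 := norm_D_M_le hm hi l
    calc _ ≤ (lam : ℝ) * ((lam : ℝ) ^ 2 * (M m i * M m l)) +
          2 * (lam : ℝ) ^ 2 * (M m l * M m i) := by gcongr
      _ = _ := by
        simp only [Pi.one_apply]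
        ring
  · rw [Set.indicator_of_notMem h]
    simp only [zeroBetween, Set.mem_ofPred_eq, not_forall] at h
    obtain ⟨t, hit, htl, ht⟩ := h
    rw [fejerSum_M_eq_zero hm hi hit htl ht, D_M_eq_zero hm (hit.trans htl) hi]
    simp

end FirstNonzero

section Measure

lemma measurableSet_cyl (n : ℕ) (x : G m) : MeasurableSet (cyl m n x) := by
  have h : cyl m n x = ⋂ j, ⋂ _ : j < n, (fun y : G m => y j) ⁻¹' {x j} := by
    ext y
    simp [cyl]
  rw [h]
  exact MeasurableSet.iInter fun j => MeasurableSet.iInter fun _ =>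
    measurable_pi_apply j trivial

lemma measurableSet_sub_mem_zeroBetween (i l : ℕ) (x : G m) :
    MeasurableSet {t : G m | x - t ∈ zeroBetween m i l} := by
  have h : {t : G m | x - t ∈ zeroBetween m i l} =
      ⋂ j, ⋂ _ : i < j, ⋂ _ : j < l, (fun y : G m => y j) ⁻¹' {x j} := by
    ext y
    simp [zeroBetween, sub_eq_zero, eq_comm]
  rw [h]
  exact MeasurableSet.iInter fun j => MeasurableSet.iInter fun _ => MeasurableSet.iInter fun _ =>
    measurable_pi_apply j trivial

variable {μ : Measure (G m)}

lemma measureReal_cyl (hμ : IsVilenkinMeasure m μ) (n : ℕ) (x : G m) :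
    μ.real (cyl m n x) = (M m n : ℝ)⁻¹ := by
  simp [Measure.real, hμ.2]

lemma sum_measureReal_zeroBetween_le (hm : ∀ k, 2 ≤ m k) (hμ : IsVilenkinMeasure m μ)
    {N i j P n : ℕ} (hij : i < j) (hjN : j ≤ N) (hNP : N ≤ P) (hPn : M m P ≤ n) {x : G m}
    (hx : x ∈ Iij m N i j) :
    ∑ l ∈ range (P + 1), M m l * μ.real ({t | x - t ∈ zeroBetween m i l} ∩ cyl m N 0) ≤
      2 * (M m j : ℝ) * n / (M m N : ℝ) ^ 2 := by
  have := hμ.1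
  have hMN : (0 : ℝ) < M m N := by exact_mod_cast M_pos hm N
  have hnN : (1 : ℝ) ≤ n / M m N := by
    rw [one_le_div hMN]
    exact_mod_cast (M_mono hm hNP).trans hPn
  have hle : ∀ l, μ.real ({t | x - t ∈ zeroBetween m i l} ∩ cyl m N 0) ≤ (M m N : ℝ)⁻¹ :=
    fun l => (measureReal_mono Set.inter_subset_right).trans_eq (measureReal_cyl hμ N 0)
  have hsum : ∀ k, ∑ l ∈ range k,
      M m l * μ.real ({t | x - t ∈ zeroBetween m i l} ∩ cyl m N 0) ≤ M m k / M m N := by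
    intro k
    calc _ ≤ ∑ l ∈ range k, (M m l : ℝ) * (M m N : ℝ)⁻¹ :=
          sum_le_sum fun l _ => mul_le_mul_of_nonneg_left (hle l) (Nat.cast_nonneg _)
      _ = ((∑ l ∈ range k, M m l : ℕ) : ℝ) / M m N := by
          rw [← sum_mul, Nat.cast_sum, div_eq_mul_inv]
      _ ≤ _ := by
          gcongr
          exact sum_M_le hm k
  rcases hjN.eq_or_lt with rfl | hjN
  · rw [Iij, if_pos rfl] at hx
    have htail : ∀ l, j ≤ l →
        M m l * μ.real ({t | x - t ∈ zeroBetween m i l} ∩ cyl m j 0) ≤ 1 := by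
      intro l hl
      have hMl : (0 : ℝ) < M m l := by exact_mod_cast M_pos hm l
      have hsub : {t | x - t ∈ zeroBetween m i l} ∩ cyl m j 0 ⊆
          cyl m l (fun s => if s < j then 0 else x s) := by
        rintro t ⟨ht, ht0⟩ s hs
        change t s = if s < j then 0 else x s
        split_ifs with hsj
        · exact ht0 s hsj
        · exact (sub_eq_zero.1 (ht s (by omega) hs)).symm
      calc _ ≤ (M m l : ℝ) * (M m l : ℝ)⁻¹ := by
            gcongr
            exact (measureReal_mono hsub).trans_eq (measureReal_cyl hμ l _)
        _ = 1 := mul_inv_cancel₀ hMl.ne'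
    obtain ⟨k, rfl⟩ := Nat.exists_eq_add_of_le hNP
    have hk : ((k + 1 : ℕ) : ℝ) ≤ n / M m j := by
      rw [le_div_iff₀ hMN]
      exact_mod_cast (Nat.mul_le_mul_right _ k.lt_two_pow_self).trans
        ((two_pow_mul_M_le hm j k).trans hPn)
    rw [add_assoc, sum_range_add]
    have h1 := hsum j
    rw [div_self hMN.ne'] at h1
    have h2 : ∑ l ∈ range (k + 1), (M m (j + l) : ℝ) *
        μ.real ({t | x - t ∈ zeroBetween m i (j + l)} ∩ cyl m j 0) ≤ ((k + 1 : ℕ) : ℝ) := by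
      refine (sum_le_sum fun l _ => htail (j + l) (Nat.le_add_right _ _)).trans ?_
      simp
    have h3 : 2 * (M m j : ℝ) * n / (M m j : ℝ) ^ 2 = 2 * (n / M m j) := by
      field_simp
    rw [h3]
    linarith
  · rw [Iij, if_neg hjN.ne] at hx
    have hzero : ∀ l, j < l → {t | x - t ∈ zeroBetween m i l} ∩ cyl m N 0 = ∅ := by
      intro l hl
      refine Set.eq_empty_of_forall_notMem ?_
      rintro t ⟨ht, ht0⟩
      have h1 := ht j hij hl
      have h2 := ht0 j hjN
      rw [Pi.sub_apply, h2] at h1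
      exact hx.2.2.2 (by simpa using h1)
    have htrunc : ∑ l ∈ range (P + 1),
        M m l * μ.real ({t | x - t ∈ zeroBetween m i l} ∩ cyl m N 0) =
        ∑ l ∈ range (j + 1),
          M m l * μ.real ({t | x - t ∈ zeroBetween m i l} ∩ cyl m N 0) := by
      refine (sum_subset (range_subset_range.2 (by omega)) fun l _ hl => ?_).symm
      rw [hzero l (by rw [mem_range] at hl; omega), measureReal_empty, mul_zero]
    have hMj : (0 : ℝ) ≤ M m j / M m N := by positivity
    rw [htrunc, sum_range_succ]
    calc _ ≤ (M m j : ℝ) / M m N + M m j * (M m N : ℝ)⁻¹ :=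
          add_le_add (hsum j) (mul_le_mul_of_nonneg_left (hle j) (Nat.cast_nonneg _))
      _ = 2 * (M m j / M m N) * 1 := by ring
      _ ≤ 2 * (M m j / M m N) * (n / M m N) := by gcongr
      _ = _ := by ring

end Measure

end Vilenkin

theorem statement4 (lam : ℕ) :
    ∃ c : ℝ, 0 < c ∧ ∀ (m : ℕ → ℕ), (∀ k, 2 ≤ m k) → (∀ k, m k ≤ lam) →
      ∀ (μ : Measure (G m)), IsVilenkinMeasure m μ →
      ∀ N : ℕ, 1 ≤ N → ∀ i j : ℕ, i < j → j ≤ N → ∀ x ∈ Iij m N i j, ∀ n : ℕ, M m N ≤ n →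
      (∫ t in cyl m N 0, ‖K m n (x - t)‖ ∂μ) ≤
        c * (M m i : ℝ) * (M m j : ℝ) / (M m N : ℝ) ^ 2 := by
  refine ⟨2 * ((lam : ℝ) ^ 3 + 2 * (lam : ℝ) ^ 2) + 1, by positivity, ?_⟩
  intro m hm hlam μ hμ N _ i j hij hjN x hx n hn
  have := hμ.1
  have hxi : x i ≠ 0 := by
    unfold Iij at hx
    split_ifs at hx
    · exact hx.1
    · exact hx.2.1
  have hn0 : (0 : ℝ) < n := by exact_mod_cast (M_pos hm N).trans_le hn
  obtain ⟨P, hPn, hnP⟩ : ∃ P, M m P ≤ n ∧ n < M m (P + 1) := by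
    have hex : ∃ s, n < M m s := ⟨n, lt_M_self hm n⟩
    obtain ⟨P, hP⟩ : ∃ P, Nat.find hex = P + 1 := by
      refine Nat.exists_eq_succ_of_ne_zero fun h => ?_
      have h0 := Nat.find_spec hex
      rw [h] at h0
      exact absurd (h0.trans_le (M_mono hm (Nat.zero_le N))) (not_lt.2 hn)
    refine ⟨P, not_lt.1 (Nat.find_min hex (by omega)), ?_⟩
    rw [← hP]
    exact Nat.find_spec hex
  have hNP : N ≤ P := by
    by_contra! h
    exact absurd (hnP.trans_le (M_mono hm h)) (not_lt.2 hn)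
  set C : ℝ := (lam : ℝ) ^ 3 + 2 * (lam : ℝ) ^ 2
  have hC : 0 ≤ C := by positivity
  set A : ℕ → Set (G m) := fun l => {t | x - t ∈ zeroBetween m i l}
  have hA : ∀ l, MeasurableSet (A l) := fun l => measurableSet_sub_mem_zeroBetween i l x
  have hint : ∀ l ∈ range (P + 1), Integrable
      (fun t => (M m l : ℝ) * (A l).indicator 1 t) (μ.restrict (cyl m N 0)) := fun l _ =>
    ((integrable_const (1 : ℝ)).indicator (hA l)).const_mul _
  calc (∫ t in cyl m N 0, ‖K m n (x - t)‖ ∂μ)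
      ≤ ∫ t in cyl m N 0, (n : ℝ)⁻¹ * (C * M m i) *
          ∑ l ∈ range (P + 1), (M m l : ℝ) * (A l).indicator 1 t ∂μ := by
        refine integral_mono_of_nonneg (.of_forall fun t => norm_nonneg _)
          ((integrable_finsetSum _ hint).const_mul _) ?_
        refine ae_restrict_of_forall_mem (measurableSet_cyl N 0) fun t ht => ?_
        have hti : (x - t) i ≠ 0 := by
          have h0 : t i = 0 := ht i (hij.trans_le hjN)
          rwa [Pi.sub_apply, h0, sub_zero]
        have h := norm_fejerSum_le_sum_indicator hm hlam hti hnP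
        change ‖(n : ℂ)⁻¹ * fejerSum m n (x - t)‖ ≤ _
        rw [norm_mul, norm_inv, Complex.norm_natCast]
        beta_reduce
        rw [mul_assoc]
        exact mul_le_mul_of_nonneg_left h (inv_nonneg.2 hn0.le)
    _ = (n : ℝ)⁻¹ * (C * M m i) *
          ∑ l ∈ range (P + 1), (M m l : ℝ) * μ.real (A l ∩ cyl m N 0) := by
        rw [integral_const_mul, integral_finsetSum _ hint]
        congr 1
        refine sum_congr rfl fun l _ => ?_
        rw [integral_const_mul, integral_indicator_one (hA l),
          measureReal_restrict_apply (hA l)]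
    _ ≤ (n : ℝ)⁻¹ * (C * M m i) * (2 * (M m j : ℝ) * n / (M m N : ℝ) ^ 2) := by
        gcongr
        exact sum_measureReal_zeroBetween_le hm hμ hij hjN hNP hPn hx
    _ = 2 * C * M m i * M m j / (M m N : ℝ) ^ 2 := by
        field_simp
    _ ≤ (2 * C + 1) * M m i * M m j / (M m N : ℝ) ^ 2 := by
        gcongr
        linarith
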